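/- Fix odd n = 2m+1 ≥ 5. Let π_1 be the rational Poisson matrix on {v ∈ ℝ^n : v_i ≠ 0 for all i} determined by τ_{ii} = v_{2i−1}, τ_{ij} = −τ_{ji} = v_{2i−1} Π_{k=i}^{j−1}(v_{2k+1}/v_{2k}) for i < j, and brackets {v_i,v_j} = (−1)^{i+j−1} τ_{⌊i/2⌋+1,⌊(j+1)/2⌋} for 1 ≤ i < j ≤ n−2, {v_i,v_{n−1}} = {v_i,v_n} = ((−1)^{i+n}/2) τ_{⌊i/2⌋+1,⌊n/2⌋} for i ≤ n−2, {v_{n−1},v_n} = (1/2)(v_n − v_{n−1}); and let π_3 be the cubic Poisson matrix determined by {v_1,v_2} = v_1v_2(2v_1+v_2), {v_i,v_{i+1}} = v_iv_{i+1}(v_i+v_{i+1}) for 2 ≤ i ≤ n−3, {v_{n−2},v_{n−1}} = v_{n−2}v_{n−1}(2v_{n−1}+v_{n−2}), {v_{n−1},v_n} = 2v_{n−1}v_n(v_n−v_{n−1}), {v_i,v_{i+2}} = v_iv_{i+1}v_{i+2} for 1 ≤ i ≤ n−3, {v_{n−2},v_n} = v_{n−2}v_n(v_{n−2}+2v_n),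 {v_{n−3},v_n} = v_{n−3}v_{n−2}v_n, other brackets zero. Then π_1 and π_3 are compatible: the sum π_1 + π_3 satisfies the Jacobi identity Σ_l ((π_1+π_3)_{li} ∂(π_1+π_3)_{jk}/∂v_l + (π_1+π_3)_{lj} ∂(π_1+π_3)_{ki}/∂v_l + (π_1+π_3)_{lk} ∂(π_1+π_3)_{ij}/∂v_l) = 0 for all i,j,k on this open set. -/

import Mathlib

/-- `coord n x i` is the 1-based `i`-th coordinate `v_i` of `x : ℝⁿ` (0 out of range). -/
noncomputable def coord (n : ℕ) (x : Fin n → ℝ) (i : ℕ) : ℝ :=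
  if h : 1 ≤ i ∧ i ≤ n then x ⟨i - 1, by omega⟩ else 0

/-- `τ_{ij} = v_{2i-1} Π_{k=i}^{j-1} (v_{2k+1}/v_{2k})` for `i ≤ j` (so `τ_{ii} = v_{2i-1}`). -/
noncomputable def tauD (n : ℕ) (x : Fin n → ℝ) (i j : ℕ) : ℝ :=
  coord n x (2*i - 1) * ∏ k ∈ Finset.Ico i j, (coord n x (2*k + 1) / coord n x (2*k))

/-- The linear/rational bracket `{v_i, v_j}` (for `i < j`) of the `D_{n+1}` Volterra system. -/
noncomputable def pi1B (n : ℕ) (x : Fin n → ℝ) (i j : ℕ) : ℝ :=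
  if 1 ≤ i ∧ i < j ∧ j ≤ n - 2 then
    (-1 : ℝ)^(i + j - 1) * tauD n x (i/2 + 1) ((j+1)/2)
  else if 1 ≤ i ∧ i ≤ n - 2 ∧ (j = n - 1 ∨ j = n) then
    ((-1 : ℝ)^(i + n) / 2) * tauD n x (i/2 + 1) (n/2)
  else if i = n - 1 ∧ j = n then (1/2) * (coord n x n - coord n x (n-1))
  else 0

/-- The skew-symmetric matrix `π₁` (1-based entries `π₁_{ij} = {v_i, v_j}`). -/
noncomputable def pi1 (n : ℕ) (x : Fin n → ℝ) (i j : ℕ) : ℝ :=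
  if i < j then pi1B n x i j else if j < i then -(pi1B n x j i) else 0

/-- The cubic bracket `{v_i, v_j}` (for `i < j`) of the Bogoyavlensky–Volterra `D_{n+1}`
system. -/
noncomputable def pi3B (n : ℕ) (x : Fin n → ℝ) (i j : ℕ) : ℝ :=
  if i = 1 ∧ j = 2 then coord n x 1 * coord n x 2 * (2 * coord n x 1 + coord n x 2)
  else if 2 ≤ i ∧ i ≤ n - 3 ∧ j = i + 1 then
    coord n x i * coord n x (i+1) * (coord n x i + coord n x (i+1))
  else if i = n - 2 ∧ j = n - 1 then
    coord n x (n-2) * coord n x (n-1) * (2 * coord n x (n-1) + coord n x (n-2))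
  else if i = n - 1 ∧ j = n then
    2 * coord n x (n-1) * coord n x n * (coord n x n - coord n x (n-1))
  else if 1 ≤ i ∧ i ≤ n - 3 ∧ j = i + 2 then
    coord n x i * coord n x (i+1) * coord n x (i+2)
  else if i = n - 2 ∧ j = n then
    coord n x (n-2) * coord n x n * (coord n x (n-2) + 2 * coord n x n)
  else if i = n - 3 ∧ j = n then
    coord n x (n-3) * coord n x (n-2) * coord n x n
  else 0

/-- The skew-symmetric matrix `π₃` (1-based entries `π₃_{ij} = {v_i, v_j}`). -/
noncomputable def pi3 (n : ℕ) (x : Fin n → ℝ) (i j : ℕ) : ℝ :=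
  if i < j then pi3B n x i j else if j < i then -(pi3B n x j i) else 0



/-- A skew-symmetric biderivation on a commutative ring. -/
structure SkewBr {A : Type*} [CommRing A] (br : A → A → A) : Prop where
  self : ∀ f, br f f = 0
  skew : ∀ f g, br f g = - br g f
  add : ∀ f g h, br (f + g) h = br f h + br g h
  mul : ∀ f g h, br (f * g) h = f * br g h + g * br f h

namespace SkewBr
variable {A : Type*} [CommRing A] {br : A → A → A}

theorem add_r (H : SkewBr br) (f g h : A) : br h (f + g) = br h f + br h g := by
  rw [H.skew h, H.add, H.skew f, H.skew g]; ring
theorem mul_r (H : SkewBr br) (f g h : A) : br h (f * g) = f * br h g + g * br h f := by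
  rw [H.skew h, H.mul, H.skew f, H.skew g]; ring
theorem zero (H : SkewBr br) (h : A) : br 0 h = 0 := by
  have := H.add 0 0 h
  simpa using this
theorem one (H : SkewBr br) (h : A) : br 1 h = 0 := by
  have := H.mul 1 1 h
  simpa using this
theorem two (H : SkewBr br) (h : A) : br 2 h = 0 := by
  have := H.add 1 1 h
  rw [one_add_one_eq_two] at this
  rw [this, H.one]; ring
theorem neg (H : SkewBr br) (f h : A) : br (-f) h = - br f h := by
  have := H.add f (-f) h
  rw [add_neg_cancel, H.zero] at this
  linear_combination -this
theorem sub (H : SkewBr br) (f g h : A) : br (f - g) h = br f h - br g h := by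
  rw [sub_eq_add_neg, H.add, H.neg]; ring
theorem neg_r (H : SkewBr br) (f h : A) : br h (-f) = - br h f := by
  rw [H.skew h, H.neg, H.skew f]; ring
theorem sub_r (H : SkewBr br) (f g h : A) : br h (f - g) = br h f - br h g := by
  rw [H.skew h, H.sub, H.skew f, H.skew g]; ring

/-- The Jacobiator. -/
def Jac (br : A → A → A) (f g h : A) : A := br (br f g) h + br (br g h) f + br (br h f) g

theorem Jac_rot (f g h : A) : Jac br f g h = Jac br g h f := by unfold Jac; ring
theorem Jac_swap (H : SkewBr br) (f g h : A) : Jac br f g h = - Jac br g f h := by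
  unfold Jac
  rw [H.skew f g, H.skew g h, H.skew h f, H.neg, H.neg, H.neg]; ring
theorem Jac_self (H : SkewBr br) (f g : A) : Jac br f f g = 0 := by
  unfold Jac
  rw [H.self, H.zero, H.skew g f, H.neg]; ring
theorem Jac_add (H : SkewBr br) (f g h k : A) :
    Jac br (f + g) h k = Jac br f h k + Jac br g h k := by
  unfold Jac
  simp only [H.add, H.add_r]; ring
theorem Jac_mul (H : SkewBr br) (f g h k : A) :
    Jac br (f * g) h k = f * Jac br g h k + g * Jac br f h k := by
  unfold Jac
  simp only [H.add, H.mul, H.mul_r]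
  rw [H.skew k g, H.skew k f]
  simp only [H.neg]
  ring
end SkewBr

/-- Bracket table in Toda-type coordinates. -/
structure TodaTable {A : Type*} [CommRing A] (br : A → A → A) (m : ℕ) (a b : ℕ → A) : Prop where
  aa : ∀ p q, q ≤ m → q = p + 1 → br (a p) (a q) = 2 * (a p * a q * b q)
  aa0 : ∀ p q, q ≤ m → p + 1 < q → br (a p) (a q) = 0
  bb : ∀ p q, 1 ≤ p → q ≤ m → q = p + 1 → br (b p) (b q) = a p * (b p + b q)
  bb0 : ∀ p q, 1 ≤ p → q ≤ m → p + 1 < q → br (b p) (b q) = 0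
  diag : ∀ p q, 2 ≤ p → p < m → q = p → br (b p) (a q) = a q * (b p * b p + 1 + a q)
  diag1 : ∀ p q, p = 1 → q = 1 → br (b p) (a q) = a q * (b p * b p + 1 + a q + a 0 * a 0)
  diagm : ∀ p q, p = m → q = m → br (b p) (a q) = a q * (b p * b p + 1 - a q * a q)
  low : ∀ p q, 1 ≤ q → p < m → p = q + 1 → br (b p) (a q) = - (a q * (b p * b p + 1 + a q))
  low1 : ∀ p q, p = 1 → q = 0 → br (b p) (a q) = - (a q * (b p * b p + 1 - a q * a q))
  lowm : ∀ p q, p = m → m = q + 1 →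
    br (b p) (a q) = - (a q * (b p * b p + 1 + a q + a m * a m))
  up : ∀ p q, 1 ≤ p → q ≤ m → q = p + 1 → br (b p) (a q) = a p * a q
  down : ∀ p q, p ≤ m → p = q + 2 → br (b p) (a q) = - (a q * a (q + 1))
  far1 : ∀ p q, 1 ≤ p → q ≤ m → p + 1 < q → br (b p) (a q) = 0
  far2 : ∀ p q, p ≤ m → q + 2 < p → br (b p) (a q) = 0

namespace TodaTable
variable {A : Type*} [CommRing A] {br : A → A → A} {m : ℕ} {a b : ℕ → A}

theorem aa_ (H : SkewBr br) (T : TodaTable br m a b) (p q : ℕ) (h : q ≤ m) (e : q = p + 1) :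
    br (a q) (a p) = - (2 * (a p * a q * b q)) := by rw [H.skew, T.aa p q h e]
theorem aa0_ (H : SkewBr br) (T : TodaTable br m a b) (p q : ℕ) (h : q ≤ m) (e : p + 1 < q) :
    br (a q) (a p) = 0 := by rw [H.skew, T.aa0 p q h e, neg_zero]
theorem bb_ (H : SkewBr br) (T : TodaTable br m a b) (p q : ℕ) (h1 : 1 ≤ p) (h : q ≤ m)
    (e : q = p + 1) : br (b q) (b p) = - (a p * (b p + b q)) := by rw [H.skew, T.bb p q h1 h e]
theorem bb0_ (H : SkewBr br) (T : TodaTable br m a b) (p q : ℕ) (h1 : 1 ≤ p) (h : q ≤ m)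
    (e : p + 1 < q) : br (b q) (b p) = 0 := by rw [H.skew, T.bb0 p q h1 h e, neg_zero]

open SkewBr

set_option linter.unusedSimpArgs false
set_option linter.unusedVariables false
set_option linter.unusedTactic false

theorem jaaa (H : SkewBr br) (T : TodaTable br m a b) (hm : 2 ≤ m) (p q r : ℕ) (h1 : p < q)
    (h2 : q < r) (h3 : r ≤ m) : Jac br (a p) (a q) (a r) = 0 := by
  unfold Jac
  have sw : ∀ p q, br (a p) (b q) = - br (b q) (a p) := fun p q => H.skew _ _
  all_goals obtain e2 | e2 : r = q + 1 ∨ q + 1 < r := by omega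
  all_goals first | subst e2 | skip
  all_goals obtain e1 | e1 : q = p + 1 ∨ p + 1 < q := by omega
  all_goals first | subst e1 | skip
  all_goals obtain e3 | e3 : p = 0 ∨ 1 ≤ p := by omega
  all_goals first | subst e3 | skip
  all_goals
    simp (disch := omega) only [H.self, sw, T.aa, T.aa0, T.aa_ H, T.aa0_ H, T.bb, T.bb0,
      T.bb_ H, T.bb0_ H, T.diag, T.diag1, T.diagm, T.low, T.low1, T.lowm, T.up, T.down, T.far1,
      T.far2, H.add, H.sub, H.neg, H.mul, H.two, H.one, H.zero, zero_add, Nat.reduceAdd, add_assoc]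
  all_goals try ring

theorem jbbb (H : SkewBr br) (T : TodaTable br m a b) (hm : 2 ≤ m) (p q r : ℕ) (h0 : 1 ≤ p)
    (h1 : p < q) (h2 : q < r) (h3 : r ≤ m) : Jac br (b p) (b q) (b r) = 0 := by
  unfold Jac
  have sw : ∀ p q, br (a p) (b q) = - br (b q) (a p) := fun p q => H.skew _ _
  all_goals obtain e2 | e2 | e2 : r = q + 1 ∨ r = q + 2 ∨ q + 2 < r := by omega
  all_goals first | subst e2 | skip
  all_goals obtain e1 | e1 | e1 : q = p + 1 ∨ q = p + 2 ∨ p + 2 < q := by omega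
  all_goals first | subst e1 | skip
  all_goals obtain e3 | e3 : p = 1 ∨ 2 ≤ p := by omega
  all_goals first | subst e3 | skip
  all_goals
    simp (disch := omega) only [H.self, sw, T.aa, T.aa0, T.aa_ H, T.aa0_ H, T.bb, T.bb0,
      T.bb_ H, T.bb0_ H, T.diag, T.diag1, T.diagm, T.low, T.low1, T.lowm, T.up, T.down, T.far1,
      T.far2, H.add, H.sub, H.neg, H.mul, H.two, H.one, H.zero, zero_add, Nat.reduceAdd, add_assoc]
  all_goals try ring

theorem jaab1 (H : SkewBr br) (T : TodaTable br m a b) (hm : 2 ≤ m) (p q r : ℕ)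
    (h1 : q = p + 1) (h2 : q ≤ m) (h3 : 1 ≤ r) (h4 : r ≤ m) : Jac br (a p) (a q) (b r) = 0 := by
  unfold Jac
  have sw : ∀ p q, br (a p) (b q) = - br (b q) (a p) := fun p q => H.skew _ _
  all_goals obtain e1 | e1 | e1 | e1 | e1 | e1 | e1 :
      r + 1 < p ∨ p = r + 1 ∨ r = p ∨ r = p + 1 ∨ r = p + 2 ∨ r = p + 3 ∨ p + 3 < r := by omega
  all_goals try omega
  all_goals obtain f1 | f1 | f1 :
      p = 0 ∨ p = 1 ∨ 2 ≤ p := by omega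
  all_goals try omega
  all_goals obtain f2 | f2 :
      r = 1 ∨ 2 ≤ r := by omega
  all_goals try omega
  all_goals obtain f3 | f3 | f3 :
      m = q ∨ m = q + 1 ∨ q + 2 ≤ m := by omega
  all_goals try omega
  all_goals obtain f4 | f4 :
      m = r ∨ r < m := by omega
  all_goals try omega
  all_goals (
    (try subst h1); (try subst e1); (try subst f1); (try subst f2); (try subst f3); (try subst f4))
  all_goals
    simp (disch := omega) only [H.self, sw, T.aa, T.aa0, T.aa_ H, T.aa0_ H, T.bb, T.bb0,
      T.bb_ H, T.bb0_ H, T.diag, T.diag1, T.diagm, T.low, T.low1, T.lowm, T.up, T.down, T.far1,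
      T.far2, H.add, H.sub, H.neg, H.mul, H.two, H.one, H.zero, zero_add, Nat.reduceAdd, add_assoc]
  all_goals try ring1

theorem jaab2 (H : SkewBr br) (T : TodaTable br m a b) (hm : 2 ≤ m) (p q r : ℕ)
    (h1 : q = p + 2) (h2 : q ≤ m) (h3 : 1 ≤ r) (h4 : r ≤ m) : Jac br (a p) (a q) (b r) = 0 := by
  unfold Jac
  have sw : ∀ p q, br (a p) (b q) = - br (b q) (a p) := fun p q => H.skew _ _
  all_goals obtain e1 | e1 | e1 | e1 | e1 | e1 | e1 | e1 :
      r + 1 < p ∨ p = r + 1 ∨ r = p ∨ r = p + 1 ∨ r = p + 2 ∨ r = p + 3 ∨ r = p + 4 ∨ p + 4 < r := by omega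
  all_goals try omega
  all_goals obtain f1 | f1 | f1 :
      p = 0 ∨ p = 1 ∨ 2 ≤ p := by omega
  all_goals try omega
  all_goals obtain f2 | f2 :
      r = 1 ∨ 2 ≤ r := by omega
  all_goals try omega
  all_goals obtain f3 | f3 | f3 :
      m = q ∨ m = q + 1 ∨ q + 2 ≤ m := by omega
  all_goals try omega
  all_goals obtain f4 | f4 :
      m = r ∨ r < m := by omega
  all_goals try omega
  all_goals (
    (try subst h1); (try subst e1); (try subst f1); (try subst f2); (try subst f3); (try subst f4))
  all_goals
    simp (disch := omega) only [H.self, sw, T.aa, T.aa0, T.aa_ H, T.aa0_ H, T.bb, T.bb0,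
      T.bb_ H, T.bb0_ H, T.diag, T.diag1, T.diagm, T.low, T.low1, T.lowm, T.up, T.down, T.far1,
      T.far2, H.add, H.sub, H.neg, H.mul, H.two, H.one, H.zero, zero_add, Nat.reduceAdd, add_assoc]
  all_goals try ring1

theorem jaab3 (H : SkewBr br) (T : TodaTable br m a b) (hm : 2 ≤ m) (p q r : ℕ)
    (h1 : q = p + 3) (h2 : q ≤ m) (h3 : 1 ≤ r) (h4 : r ≤ m) : Jac br (a p) (a q) (b r) = 0 := by
  unfold Jac
  have sw : ∀ p q, br (a p) (b q) = - br (b q) (a p) := fun p q => H.skew _ _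
  all_goals obtain e1 | e1 | e1 | e1 | e1 | e1 | e1 | e1 | e1 :
      r + 1 < p ∨ p = r + 1 ∨ r = p ∨ r = p + 1 ∨ r = p + 2 ∨ r = p + 3 ∨ r = p + 4 ∨ r = p + 5 ∨ p + 5 < r := by omega
  all_goals try omega
  all_goals obtain f1 | f1 | f1 :
      p = 0 ∨ p = 1 ∨ 2 ≤ p := by omega
  all_goals try omega
  all_goals obtain f2 | f2 :
      r = 1 ∨ 2 ≤ r := by omega
  all_goals try omega
  all_goals obtain f3 | f3 | f3 :
      m = q ∨ m = q + 1 ∨ q + 2 ≤ m := by omega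
  all_goals try omega
  all_goals obtain f4 | f4 :
      m = r ∨ r < m := by omega
  all_goals try omega
  all_goals (
    (try subst h1); (try subst e1); (try subst f1); (try subst f2); (try subst f3); (try subst f4))
  all_goals
    simp (disch := omega) only [H.self, sw, T.aa, T.aa0, T.aa_ H, T.aa0_ H, T.bb, T.bb0,
      T.bb_ H, T.bb0_ H, T.diag, T.diag1, T.diagm, T.low, T.low1, T.lowm, T.up, T.down, T.far1,
      T.far2, H.add, H.sub, H.neg, H.mul, H.two, H.one, H.zero, zero_add, Nat.reduceAdd, add_assoc]
  all_goals try ring1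

theorem jaab4 (H : SkewBr br) (T : TodaTable br m a b) (hm : 2 ≤ m) (p q r : ℕ)
    (h1 : p + 3 < q) (h2 : q ≤ m) (h3 : 1 ≤ r) (h4 : r ≤ m) : Jac br (a p) (a q) (b r) = 0 := by
  unfold Jac
  have sw : ∀ p q, br (a p) (b q) = - br (b q) (a p) := fun p q => H.skew _ _
  all_goals obtain e1 | e1 | e1 | e1 | e1 | e1 | e1 | e1 | e1 | e1 | e1 :
      r + 1 < p ∨ p = r + 1 ∨ r = p ∨ r = p + 1 ∨ r = p + 2 ∨ p + 2 < r ∧ r + 1 < q ∨ q = r + 1 ∨ r = q ∨ r = q + 1 ∨ r = q + 2 ∨ q + 2 < r := by omega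
  all_goals try omega
  all_goals obtain f1 | f1 | f1 :
      p = 0 ∨ p = 1 ∨ 2 ≤ p := by omega
  all_goals try omega
  all_goals obtain f2 | f2 :
      r = 1 ∨ 2 ≤ r := by omega
  all_goals try omega
  all_goals obtain f3 | f3 | f3 :
      m = q ∨ m = q + 1 ∨ q + 2 ≤ m := by omega
  all_goals try omega
  all_goals obtain f4 | f4 :
      m = r ∨ r < m := by omega
  all_goals try omega
  all_goals (
    (try subst h1); (try subst e1); (try subst f1); (try subst f2); (try subst f3); (try subst f4))
  all_goals
    simp (disch := omega) only [H.self, sw, T.aa, T.aa0, T.aa_ H, T.aa0_ H, T.bb, T.bb0,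
      T.bb_ H, T.bb0_ H, T.diag, T.diag1, T.diagm, T.low, T.low1, T.lowm, T.up, T.down, T.far1,
      T.far2, H.add, H.sub, H.neg, H.mul, H.two, H.one, H.zero, zero_add, Nat.reduceAdd, add_assoc]
  all_goals try ring1

theorem jabb1 (H : SkewBr br) (T : TodaTable br m a b) (hm : 2 ≤ m) (p q r : ℕ)
    (h1 : r = q + 1) (h2 : 1 ≤ q) (h3 : r ≤ m) (h4 : p ≤ m) : Jac br (a p) (b q) (b r) = 0 := by
  unfold Jac
  have sw : ∀ p q, br (a p) (b q) = - br (b q) (a p) := fun p q => H.skew _ _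
  all_goals obtain e1 | e1 | e1 | e1 | e1 | e1 | e1 :
      p + 2 < q ∨ q = p + 2 ∨ q = p + 1 ∨ p = q ∨ p = q + 1 ∨ p = q + 2 ∨ q + 2 < p := by omega
  all_goals try omega
  all_goals obtain f1 | f1 :
      p = 0 ∨ 1 ≤ p := by omega
  all_goals try omega
  all_goals obtain f2 | f2 :
      q = 1 ∨ 2 ≤ q := by omega
  all_goals try omega
  all_goals obtain f3 | f3 :
      m = r ∨ r < m := by omega
  all_goals try omega
  all_goals obtain f4 | f4 :
      m = p ∨ p < m := by omega
  all_goals try omega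
  all_goals (
    (try subst h1); (try subst e1); (try subst f1); (try subst f2); (try subst f3); (try subst f4))
  all_goals
    simp (disch := omega) only [H.self, sw, T.aa, T.aa0, T.aa_ H, T.aa0_ H, T.bb, T.bb0,
      T.bb_ H, T.bb0_ H, T.diag, T.diag1, T.diagm, T.low, T.low1, T.lowm, T.up, T.down, T.far1,
      T.far2, H.add, H.sub, H.neg, H.mul, H.two, H.one, H.zero, zero_add, Nat.reduceAdd, add_assoc]
  all_goals try ring1

theorem jabb2 (H : SkewBr br) (T : TodaTable br m a b) (hm : 2 ≤ m) (p q r : ℕ)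
    (h1 : r = q + 2) (h2 : 1 ≤ q) (h3 : r ≤ m) (h4 : p ≤ m) : Jac br (a p) (b q) (b r) = 0 := by
  unfold Jac
  have sw : ∀ p q, br (a p) (b q) = - br (b q) (a p) := fun p q => H.skew _ _
  all_goals obtain e1 | e1 | e1 | e1 | e1 | e1 | e1 | e1 :
      p + 2 < q ∨ q = p + 2 ∨ q = p + 1 ∨ p = q ∨ p = q + 1 ∨ p = q + 2 ∨ p = q + 3 ∨ q + 3 < p := by omega
  all_goals try omega
  all_goals obtain f1 | f1 :
      p = 0 ∨ 1 ≤ p := by omega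
  all_goals try omega
  all_goals obtain f2 | f2 :
      q = 1 ∨ 2 ≤ q := by omega
  all_goals try omega
  all_goals obtain f3 | f3 :
      m = r ∨ r < m := by omega
  all_goals try omega
  all_goals obtain f4 | f4 :
      m = p ∨ p < m := by omega
  all_goals try omega
  all_goals (
    (try subst h1); (try subst e1); (try subst f1); (try subst f2); (try subst f3); (try subst f4))
  all_goals
    simp (disch := omega) only [H.self, sw, T.aa, T.aa0, T.aa_ H, T.aa0_ H, T.bb, T.bb0,
      T.bb_ H, T.bb0_ H, T.diag, T.diag1, T.diagm, T.low, T.low1, T.lowm, T.up, T.down, T.far1,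
      T.far2, H.add, H.sub, H.neg, H.mul, H.two, H.one, H.zero, zero_add, Nat.reduceAdd, add_assoc]
  all_goals try ring1

theorem jabb3 (H : SkewBr br) (T : TodaTable br m a b) (hm : 2 ≤ m) (p q r : ℕ)
    (h1 : r = q + 3) (h2 : 1 ≤ q) (h3 : r ≤ m) (h4 : p ≤ m) : Jac br (a p) (b q) (b r) = 0 := by
  unfold Jac
  have sw : ∀ p q, br (a p) (b q) = - br (b q) (a p) := fun p q => H.skew _ _
  all_goals obtain e1 | e1 | e1 | e1 | e1 | e1 | e1 | e1 | e1 :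
      p + 2 < q ∨ q = p + 2 ∨ q = p + 1 ∨ p = q ∨ p = q + 1 ∨ p = q + 2 ∨ p = q + 3 ∨ p = q + 4 ∨ q + 4 < p := by omega
  all_goals try omega
  all_goals obtain f1 | f1 :
      p = 0 ∨ 1 ≤ p := by omega
  all_goals try omega
  all_goals obtain f2 | f2 :
      q = 1 ∨ 2 ≤ q := by omega
  all_goals try omega
  all_goals obtain f3 | f3 :
      m = r ∨ r < m := by omega
  all_goals try omega
  all_goals obtain f4 | f4 :
      m = p ∨ p < m := by omega
  all_goals try omega
  all_goals (
    (try subst h1); (try subst e1); (try subst f1); (try subst f2); (try subst f3); (try subst f4))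
  all_goals
    simp (disch := omega) only [H.self, sw, T.aa, T.aa0, T.aa_ H, T.aa0_ H, T.bb, T.bb0,
      T.bb_ H, T.bb0_ H, T.diag, T.diag1, T.diagm, T.low, T.low1, T.lowm, T.up, T.down, T.far1,
      T.far2, H.add, H.sub, H.neg, H.mul, H.two, H.one, H.zero, zero_add, Nat.reduceAdd, add_assoc]
  all_goals try ring1

theorem jabb4 (H : SkewBr br) (T : TodaTable br m a b) (hm : 2 ≤ m) (p q r : ℕ)
    (h1 : q + 3 < r) (h2 : 1 ≤ q) (h3 : r ≤ m) (h4 : p ≤ m) : Jac br (a p) (b q) (b r) = 0 := by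
  unfold Jac
  have sw : ∀ p q, br (a p) (b q) = - br (b q) (a p) := fun p q => H.skew _ _
  all_goals obtain e1 | e1 | e1 | e1 | e1 | e1 | e1 | e1 | e1 | e1 | e1 :
      p + 2 < q ∨ q = p + 2 ∨ q = p + 1 ∨ p = q ∨ p = q + 1 ∨ q + 1 < p ∧ p + 2 < r ∨ r = p + 2 ∨ r = p + 1 ∨ r = p ∨ p = r + 1 ∨ r + 1 < p := by omega
  all_goals try omega
  all_goals obtain f1 | f1 :
      p = 0 ∨ 1 ≤ p := by omega
  all_goals try omega
  all_goals obtain f2 | f2 :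
      q = 1 ∨ 2 ≤ q := by omega
  all_goals try omega
  all_goals obtain f3 | f3 :
      m = r ∨ r < m := by omega
  all_goals try omega
  all_goals obtain f4 | f4 :
      m = p ∨ p < m := by omega
  all_goals try omega
  all_goals (
    (try subst h1); (try subst e1); (try subst f1); (try subst f2); (try subst f3); (try subst f4))
  all_goals
    simp (disch := omega) only [H.self, sw, T.aa, T.aa0, T.aa_ H, T.aa0_ H, T.bb, T.bb0,
      T.bb_ H, T.bb0_ H, T.diag, T.diag1, T.diagm, T.low, T.low1, T.lowm, T.up, T.down, T.far1,
      T.far2, H.add, H.sub, H.neg, H.mul, H.two, H.one, H.zero, zero_add, Nat.reduceAdd, add_assoc]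
  all_goals try ring1

theorem jaab (H : SkewBr br) (T : TodaTable br m a b) (hm : 2 ≤ m) (p q r : ℕ)
    (h1 : p < q) (h2 : q ≤ m) (h3 : 1 ≤ r) (h4 : r ≤ m) : Jac br (a p) (a q) (b r) = 0 := by
  obtain e | e | e | e : q = p + 1 ∨ q = p + 2 ∨ q = p + 3 ∨ p + 3 < q := by omega
  · exact jaab1 H T hm p q r e h2 h3 h4
  · exact jaab2 H T hm p q r e h2 h3 h4
  · exact jaab3 H T hm p q r e h2 h3 h4
  · exact jaab4 H T hm p q r e h2 h3 h4

theorem jabb (H : SkewBr br) (T : TodaTable br m a b) (hm : 2 ≤ m) (p q r : ℕ)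
    (h1 : q < r) (h2 : 1 ≤ q) (h3 : r ≤ m) (h4 : p ≤ m) : Jac br (a p) (b q) (b r) = 0 := by
  obtain e | e | e | e : r = q + 1 ∨ r = q + 2 ∨ r = q + 3 ∨ q + 3 < r := by omega
  · exact jabb1 H T hm p q r e h2 h3 h4
  · exact jabb2 H T hm p q r e h2 h3 h4
  · exact jabb3 H T hm p q r e h2 h3 h4
  · exact jabb4 H T hm p q r e h2 h3 h4

/-- The generators. -/
def IsGen (m : ℕ) (a b : ℕ → A) (f : A) : Prop :=
  (∃ p, p ≤ m ∧ f = a p) ∨ (∃ p, 1 ≤ p ∧ p ≤ m ∧ f = b p)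

theorem jac_of_ne {f : ℕ → A} {P : ℕ → Prop} (H : SkewBr br) (g : A)
    (h : ∀ p q, P p → P q → p < q → Jac br (f p) (f q) g = 0) (p q : ℕ) (hp : P p) (hq : P q) :
    Jac br (f p) (f q) g = 0 := by
  rcases lt_trichotomy p q with e | e | e
  · exact h p q hp hq e
  · subst e; exact Jac_self H _ _
  · rw [Jac_swap H, h q p hq hp e, neg_zero]

theorem jac_of_ne3 {f : ℕ → A} {P : ℕ → Prop} (H : SkewBr br)
    (h : ∀ p q r, P p → P q → P r → p < q → q < r → Jac br (f p) (f q) (f r) = 0)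
    (p q r : ℕ) (hp : P p) (hq : P q) (hr : P r) : Jac br (f p) (f q) (f r) = 0 := by
  refine jac_of_ne (f := f) (P := P) H (f r) (fun p q hp hq hpq => ?_) p q hp hq
  rcases lt_trichotomy q r with e | e | e
  · exact h p q r hp hq hr hpq e
  · subst e; rw [Jac_rot, Jac_self H]
  rcases lt_trichotomy p r with e' | e' | e'
  · rw [Jac_swap H, Jac_rot, h p r q hp hr hq e' e, neg_zero]
  · subst e'; rw [← Jac_rot, Jac_self H]
  · rw [← Jac_rot, h r p q hr hp hq e' hpq]

theorem jac_gen (H : SkewBr br) (T : TodaTable br m a b) (hm : 2 ≤ m) {f g h : A}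
    (hf : IsGen m a b f) (hg : IsGen m a b g) (hh : IsGen m a b h) : Jac br f g h = 0 := by
  have kaab : ∀ p q r, p ≤ m → q ≤ m → 1 ≤ r → r ≤ m → Jac br (a p) (a q) (b r) = 0 :=
    fun p q r hp hq h1 h2 => jac_of_ne (f := a) (P := fun p => p ≤ m) H (b r)
      (fun p q hp hq hpq => jaab H T hm p q r hpq hq h1 h2) p q hp hq
  have kbba : ∀ p q r, (1 ≤ p ∧ p ≤ m) → (1 ≤ q ∧ q ≤ m) → r ≤ m →
      Jac br (b p) (b q) (a r) = 0 :=
    fun p q r hp hq h1 => jac_of_ne (f := b) (P := fun p => 1 ≤ p ∧ p ≤ m) H (a r)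
      (fun p q hp hq hpq => by rw [← Jac_rot]; exact jabb H T hm r p q hpq hp.1 hq.2 h1) p q hp hq
  rcases hf with ⟨p, hp, rfl⟩ | ⟨p, hp, hp', rfl⟩ <;>
  rcases hg with ⟨q, hq, rfl⟩ | ⟨q, hq, hq', rfl⟩ <;>
  rcases hh with ⟨r, hr, rfl⟩ | ⟨r, hr, hr', rfl⟩
  · exact jac_of_ne3 (f := a) (P := fun p => p ≤ m) H
      (fun p q r _ _ hr h1 h2 => jaaa H T hm p q r h1 h2 hr) p q r hp hq hr
  · exact kaab _ _ _ hp hq hr hr'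
  · rw [← Jac_rot]; exact kaab _ _ _ hr hp hq hq'
  · rw [Jac_rot]; exact kbba _ _ _ ⟨hq, hq'⟩ ⟨hr, hr'⟩ hp
  · rw [Jac_rot]; exact kaab _ _ _ hq hr hp hp'
  · rw [← Jac_rot]; exact kbba _ _ _ ⟨hr, hr'⟩ ⟨hp, hp'⟩ hq
  · exact kbba _ _ _ ⟨hp, hp'⟩ ⟨hq, hq'⟩ hr
  · exact jac_of_ne3 (f := b) (P := fun p => 1 ≤ p ∧ p ≤ m) H
      (fun p q r hp _ hr h1 h2 => jbbb H T hm p q r hp.1 h1 h2 hr.2) p q r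
        ⟨hp, hp'⟩ ⟨hq, hq'⟩ ⟨hr, hr'⟩

end TodaTable

set_option linter.unusedSimpArgs false
set_option linter.unusedVariables false
set_option linter.unusedTactic false

/-- The rational bracket, in Volterra coordinates `V 1, …, V (2m), d`. -/
structure VTab1 {A : Type*} [CommRing A] (br : A → A → A) (m : ℕ) (V : ℕ → A) (d : A) : Prop where
  s1 : ∀ i q, 1 ≤ i → i < 2 * q + 1 → q < m →
    br (V i) (V (2 * q + 1)) + br (V i) (V (2 * q + 2)) = 0
  s2 : ∀ i q, 1 ≤ i → i < 2 * q → q < m →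
    V (2 * q + 1) * br (V i) (V (2 * q)) + V (2 * q) * br (V i) (V (2 * q + 1)) = 0
  s3 : ∀ q, q < m → br (V (2 * q + 1)) (V (2 * q + 2)) = V (2 * q + 1)
  s4 : ∀ q, 1 ≤ q → q < m → br (V (2 * q)) (V (2 * q + 1)) = V (2 * q + 1)
  d0 : ∀ i, 1 ≤ i → i < 2 * m → br (V i) d = 0
  d1 : br (V (2 * m)) d = d

/-- The cubic bracket, in Volterra coordinates `V 1, …, V (2m), d`. -/
structure VTab3 {A : Type*} [CommRing A] (br : A → A → A) (m : ℕ) (V : ℕ → A) (d : A) : Prop where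
  n0 : ∀ i j, i = 1 → j = 2 → br (V i) (V j) = V i * V j * (2 * V i + V j)
  n1 : ∀ i j, 2 ≤ i → j < 2 * m → j = i + 1 → br (V i) (V j) = V i * V j * (V i + V j)
  nm : ∀ i j, j = 2 * m → j = i + 1 → br (V i) (V j) = V i * (V i * V j + V j * V j + d * d)
  n2 : ∀ i j, 1 ≤ i → j ≤ 2 * m → j = i + 2 → br (V i) (V j) = V i * V (i + 1) * V j
  n3 : ∀ i j, 1 ≤ i → j ≤ 2 * m → i + 2 < j → br (V i) (V j) = 0
  d3 : ∀ i, 1 ≤ i → i + 2 < 2 * m → br (V i) d = 0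
  d2 : ∀ i, i + 2 = 2 * m → br (V i) d = V i * V (i + 1) * d
  d1 : ∀ i, i + 1 = 2 * m → br (V i) d = V i * d * (V i + 2 * V (i + 1))
  d0 : ∀ i, i = 2 * m → br (V i) d = d * (V i * V i - d * d)

/-- Change of coordinates. -/
structure Chg {A : Type*} [CommRing A] (m : ℕ) (V : ℕ → A) (d : A) (a b : ℕ → A) : Prop where
  a0 : a 0 = V 1
  am : ∀ p, p = m → a p = d
  ap : ∀ p, 1 ≤ p → p < m → a p = V (2 * p) * V (2 * p + 1)
  bp : ∀ p, b (p + 1) = V (2 * p + 1) + V (2 * p + 2)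

/-- The linear bracket table. -/
structure LinTab {A : Type*} [CommRing A] (br : A → A → A) (m : ℕ) (a b : ℕ → A) : Prop where
  aa : ∀ p q, q ≤ m → p < q → br (a p) (a q) = 0
  bb : ∀ p q, 1 ≤ p → q ≤ m → p < q → br (b p) (b q) = 0
  diag : ∀ p, 1 ≤ p → p ≤ m → br (b p) (a p) = a p
  low : ∀ q, q < m → br (b (q + 1)) (a q) = - a q
  far1 : ∀ p q, 1 ≤ p → q ≤ m → p < q → br (b p) (a q) = 0
  far2 : ∀ p q, p ≤ m → q + 1 < p → br (b p) (a q) = 0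

section
variable {A : Type*} [CommRing A] {br : A → A → A} {m : ℕ} {V a b : ℕ → A} {d : A}

theorem linTab (H : SkewBr br) (hm : 2 ≤ m) (T : VTab1 br m V d) (C : Chg m V d a b) :
    LinTab br m a b := by
  have L1 : ∀ i q, 1 ≤ i → i < 2 * q + 1 → q < m → br (V i) (b (q + 1)) = 0 := by
    intro i q h1 h2 h3
    rw [C.bp, H.add_r, T.s1 i q h1 h2 h3]
  have L2 : ∀ i q, 1 ≤ i → i < 2 * q → q ≤ m → br (V i) (a q) = 0 := by
    intro i q h1 h2 h3
    rcases h3.lt_or_eq with h | h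
    · rw [C.ap q (by omega) h, H.mul_r]
      linear_combination T.s2 i q h1 h2 h
    · rw [C.am q h, T.d0 i h1 (by omega)]
  -- brackets of `a p` against something commuting with its factors
  have La : ∀ p g, p < m → (∀ i, 1 ≤ i → i ≤ 2 * p + 1 → br (V i) g = 0) → br (a p) g = 0 := by
    intro p g hp h
    rcases Nat.eq_zero_or_pos p with e | e
    · subst e; rw [C.a0]; exact h 1 le_rfl (by omega)
    · rw [C.ap p e hp, H.mul, h _ (by omega) (by omega), h _ (by omega) (by omega)]; ring
  have Lb : ∀ p g, (∀ i, 1 ≤ i → i ≤ 2 * p + 2 → br (V i) g = 0) → br (b (p + 1)) g = 0 := by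
    intro p g h
    rw [C.bp, H.add, h _ (by omega) (by omega), h _ (by omega) (by omega)]; ring
  refine ⟨?_, ?_, ?_, ?_, ?_, ?_⟩
  · intro p q h1 h2
    exact La p _ (by omega) (fun i hi hi' => L2 i q hi (by omega) h1)
  · intro p q h1 h2 h3
    obtain ⟨p, rfl⟩ : ∃ k, p = k + 1 := ⟨p - 1, by omega⟩
    obtain ⟨q, rfl⟩ : ∃ k, q = k + 1 := ⟨q - 1, by omega⟩
    exact Lb p _ (fun i hi hi' => L1 i q hi (by omega) (by omega))
  · intro p h1 h2
    obtain ⟨p, rfl⟩ : ∃ k, p = k + 1 := ⟨p - 1, by omega⟩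
    rw [C.bp, H.add, L2 _ _ (by omega) (by omega) h2]
    rcases h2.lt_or_eq with h | h
    · rw [C.ap _ h1 h, H.mul_r, show 2 * p + 2 = 2 * (p + 1) by ring, H.self, T.s4 _ h1 h]; ring
    · rw [C.am _ h, show 2 * p + 2 = 2 * m by omega, T.d1]; ring
  · intro q h1
    rw [H.skew]
    rcases Nat.eq_zero_or_pos q with e | e
    · subst e
      have := T.s3 0 (by omega)
      simp only [mul_zero, zero_add] at this
      rw [C.a0, C.bp, H.add_r]
      simp only [mul_zero, zero_add]
      rw [this, H.self]; ring
    · rw [C.ap q e h1, H.mul, L1 (2 * q) q (by omega) (by omega) h1, C.bp, H.add_r, H.self,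
        T.s3 q h1]; ring
  · intro p q h1 h2 h3
    obtain ⟨p, rfl⟩ : ∃ k, p = k + 1 := ⟨p - 1, by omega⟩
    exact Lb p _ (fun i hi hi' => L2 i q hi (by omega) h2)
  · intro p q h1 h2
    obtain ⟨p, rfl⟩ : ∃ k, p = k + 1 := ⟨p - 1, by omega⟩
    rw [H.skew, La q _ (by omega) (fun i hi hi' => L1 i p hi (by omega) (by omega)), neg_zero]

theorem todaTab {br1 br3 : A → A → A} (H : SkewBr br3) (hm : 2 ≤ m)
    (L : LinTab br1 m a b) (T : VTab3 br3 m V d) (C : Chg m V d a b)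
    (hbr : ∀ f g, br f g = br1 f g + br3 f g) : TodaTable br m a b := by
  have n0 : ∀ i j, i = 1 → j = 2 → br3 (V j) (V i) = - (V i * V j * (2 * V i + V j)) :=
    fun i j h1 h2 => by rw [H.skew, T.n0 i j h1 h2]
  have n1 : ∀ i j, 2 ≤ i → j < 2 * m → j = i + 1 →
      br3 (V j) (V i) = - (V i * V j * (V i + V j)) :=
    fun i j h1 h2 h3 => by rw [H.skew, T.n1 i j h1 h2 h3]
  have nm : ∀ i j, j = 2 * m → j = i + 1 →
      br3 (V j) (V i) = - (V i * (V i * V j + V j * V j + d * d)) :=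
    fun i j h1 h2 => by rw [H.skew, T.nm i j h1 h2]
  have n2 : ∀ i j, 1 ≤ i → j ≤ 2 * m → j = i + 2 →
      br3 (V j) (V i) = - (V i * V (i + 1) * V j) :=
    fun i j h1 h2 h3 => by rw [H.skew, T.n2 i j h1 h2 h3]
  have n3 : ∀ i j, 1 ≤ i → j ≤ 2 * m → i + 2 < j → br3 (V j) (V i) = 0 :=
    fun i j h1 h2 h3 => by rw [H.skew, T.n3 i j h1 h2 h3, neg_zero]
  refine ⟨?_, ?_, ?_, ?_, ?_, ?_, ?_, ?_, ?_, ?_, ?_, ?_, ?_, ?_⟩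
  case' refine_1 =>
    intro p q h e
    obtain h0 | h0 : p = 0 ∨ 1 ≤ p := by omega
    all_goals obtain h9 | h9 : q = m ∨ q < m := by omega
    all_goals rw [hbr, L.aa p q h (by omega)]
  case' refine_2 =>
    intro p q h e
    obtain h0 | h0 : p = 0 ∨ 1 ≤ p := by omega
    all_goals obtain h9 | h9 : q = m ∨ q < m := by omega
    all_goals rw [hbr, L.aa p q h (by omega)]
  case' refine_3 =>
    intro p q h1 h e
    rw [hbr, L.bb p q h1 h (by omega)]
    obtain ⟨p, rfl⟩ : ∃ k, p = k + 1 := ⟨p - 1, by omega⟩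
  case' refine_4 =>
    intro p q h1 h e
    rw [hbr, L.bb p q h1 h (by omega)]
    obtain ⟨p, rfl⟩ : ∃ k, p = k + 1 := ⟨p - 1, by omega⟩
    obtain ⟨q, rfl⟩ : ∃ k, q = k + 1 := ⟨q - 1, by omega⟩
  case' refine_5 =>
    intro p q h1 h2 e
    rw [hbr, e, L.diag p (by omega) (by omega)]
    obtain ⟨p, rfl⟩ : ∃ k, p = k + 1 := ⟨p - 1, by omega⟩
  case' refine_6 =>
    intro p q e1 e2
    subst e1
    rw [hbr, e2, L.diag 1 (by omega) (by omega), show b 1 = V 1 + V 2 from C.bp 0]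
  case' refine_7 =>
    intro p q e1 e2
    rw [hbr, e1, e2, L.diag m (by omega) (by omega)]
    obtain ⟨p, rfl⟩ : ∃ k, m = k + 1 := ⟨m - 1, by omega⟩
  case' refine_8 =>
    intro p q h1 h e
    subst e
    rw [hbr, L.low q (by omega)]
  case' refine_9 =>
    intro p q e1 e2
    subst e1 e2
    rw [hbr, L.low 0 (by omega), show b (0 + 1) = V 1 + V 2 from C.bp 0]
  case' refine_10 =>
    intro p q e1 e2
    rw [e1, e2, hbr, L.low q (by omega)]
  case' refine_11 =>
    intro p q h1 h e
    rw [hbr, L.far1 p q h1 h (by omega)]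
    obtain ⟨p, rfl⟩ : ∃ k, p = k + 1 := ⟨p - 1, by omega⟩
    obtain h0 | h0 : p = 0 ∨ 1 ≤ p := by omega
    all_goals obtain h9 | h9 : q = m ∨ q < m := by omega
  case' refine_12 =>
    intro p q h e
    subst e
    rw [hbr, L.far2 (q + 1 + 1) q h (by omega)]
    obtain h0 | h0 : q = 0 ∨ 1 ≤ q := by omega
  case' refine_13 =>
    intro p q h1 h e
    rw [hbr, L.far1 p q h1 h (by omega)]
    obtain ⟨p, rfl⟩ : ∃ k, p = k + 1 := ⟨p - 1, by omega⟩
    obtain h9 | h9 : q = m ∨ q < m := by omega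
  case' refine_14 =>
    intro p q h e
    rw [hbr, L.far2 p q h (by omega)]
    obtain ⟨p, rfl⟩ : ∃ k, p = k + 1 := ⟨p - 1, by omega⟩
    obtain h0 | h0 : q = 0 ∨ 1 ≤ q := by omega
  all_goals try omega
  all_goals try subst e
  all_goals try subst h0
  all_goals
    simp (disch := omega) only [C.a0, C.am, C.ap, C.bp, mul_add, mul_one, mul_zero, zero_add,
      add_assoc, Nat.reduceAdd, Nat.reduceMul, H.add, H.mul, H.add_r, H.mul_r, H.self,
      T.n0, T.n1, T.nm, T.n2, T.n3, T.d0, T.d1, T.d2, T.d3, n0, n1, nm, n2, n3]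
  all_goals try ring1
end

section
open SkewBr
variable {A : Type*} [CommRing A] {br : A → A → A} {m : ℕ} {V a b : ℕ → A} {d : A}

theorem jac_sub (H : SkewBr br) (f g h k : A) :
    Jac br (f - g) h k = Jac br f h k - Jac br g h k := by
  have := Jac_add H (f - g) g h k
  rw [sub_add_cancel] at this
  linear_combination -this

theorem jac_div (H : SkewBr br) {u f h k : A} (hu : IsUnit u) (h1 : Jac br u h k = 0)
    (h2 : Jac br (u * f) h k = 0) : Jac br f h k = 0 := by
  rw [Jac_mul H, h1, mul_zero, add_zero] at h2
  exact (hu.mul_right_eq_zero).1 h2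

theorem jac_two (H : SkewBr br) (h k : A) : Jac br 2 h k = 0 := by
  unfold Jac
  rw [H.two, H.zero, H.skew k 2, H.two, neg_zero, H.zero, H.skew, H.two]
  ring

theorem jac_V1 (H : SkewBr br) (hm : 2 ≤ m) (C : Chg m V d a b)
    (hu : ∀ p, 1 ≤ p → p < m → IsUnit (V (2 * p))) (g h : A)
    (hg : ∀ f, TodaTable.IsGen m a b f → Jac br f g h = 0) :
    Jac br d g h = 0 ∧ ∀ i, 1 ≤ i → i ≤ 2 * m → Jac br (V i) g h = 0 := by
  have hb : ∀ p, p < m → Jac br (b (p + 1)) g h = 0 :=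
    fun p hp => hg _ (Or.inr ⟨p + 1, by omega, by omega, rfl⟩)
  have ha : ∀ p, p ≤ m → Jac br (a p) g h = 0 := fun p hp => hg _ (Or.inl ⟨p, hp, rfl⟩)
  have key : ∀ p, p < m → Jac br (V (2 * p + 1)) g h = 0 ∧ Jac br (V (2 * p + 2)) g h = 0 := by
    intro p
    induction p with
    | zero =>
      intro hp
      have h1 : Jac br (V (2 * 0 + 1)) g h = 0 := by
        have := ha 0 (by omega)
        rwa [C.a0] at this
      refine ⟨h1, ?_⟩
      have h2 := hb 0 hp
      rw [C.bp, Jac_add H, h1, zero_add] at h2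
      exact h2
    | succ p ih =>
      intro hp
      have h1 : Jac br (V (2 * (p + 1) + 1)) g h = 0 := by
        have h2 := ha (p + 1) (by omega)
        rw [C.ap _ (by omega) hp] at h2
        exact jac_div H (hu _ (by omega) hp) (ih (by omega)).2 h2
      refine ⟨h1, ?_⟩
      have h2 := hb _ hp
      rw [C.bp, Jac_add H, h1, zero_add] at h2
      exact h2
  constructor
  · rw [← C.am m rfl]; exact ha m le_rfl
  · intro i h1 h2
    rcases Nat.even_or_odd' i with ⟨k, e | e⟩
    · have := (key (k - 1) (by omega)).2
      rwa [show 2 * (k - 1) + 2 = i by omega] at this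
    · have := (key k (by omega)).1
      rwa [← e] at this

theorem jac_v1 (H : SkewBr br) (hm : 2 ≤ m) (C : Chg m V d a b)
    (hu : ∀ p, 1 ≤ p → p < m → IsUnit (V (2 * p))) (h2 : IsUnit (2 : A)) (v : ℕ → A)
    (hv : ∀ i, 1 ≤ i → i < 2 * m → v i = V i) (hs : V (2 * m) = v (2 * m) + v (2 * m + 1))
    (hd : d = v (2 * m + 1) - v (2 * m)) (g h : A)
    (hg : ∀ f, TodaTable.IsGen m a b f → Jac br f g h = 0) :
    ∀ i, 1 ≤ i → i ≤ 2 * m + 1 → Jac br (v i) g h = 0 := by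
  obtain ⟨k1, k2⟩ := jac_V1 H hm C hu g h hg
  intro i h3 h4
  obtain e | e | e : i < 2 * m ∨ i = 2 * m ∨ i = 2 * m + 1 := by omega
  · rw [hv i h3 e]; exact k2 i h3 (by omega)
  · apply jac_div H h2 (jac_two H g h)
    rw [e, show 2 * v (2 * m) = V (2 * m) - d by rw [hs, hd]; ring, jac_sub H, k1,
      k2 _ (by omega) le_rfl, sub_zero]
  · apply jac_div H h2 (jac_two H g h)
    rw [e, show 2 * v (2 * m + 1) = V (2 * m) + d by rw [hs, hd]; ring, Jac_add H, k1,
      k2 _ (by omega) le_rfl, add_zero]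

theorem jac_v (H : SkewBr br) (hm : 2 ≤ m) (T : TodaTable br m a b) (C : Chg m V d a b)
    (hu : ∀ p, 1 ≤ p → p < m → IsUnit (V (2 * p))) (h2 : IsUnit (2 : A)) (v : ℕ → A)
    (hv : ∀ i, 1 ≤ i → i < 2 * m → v i = V i) (hs : V (2 * m) = v (2 * m) + v (2 * m + 1))
    (hd : d = v (2 * m + 1) - v (2 * m)) (i j k : ℕ) (hi : 1 ≤ i) (hi' : i ≤ 2 * m + 1)
    (hj : 1 ≤ j) (hj' : j ≤ 2 * m + 1) (hk : 1 ≤ k) (hk' : k ≤ 2 * m + 1) :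
    Jac br (v i) (v j) (v k) = 0 := by
  have key := jac_v1 H hm C hu h2 v hv hs hd
  refine key _ _ (fun f hf => ?_) i hi hi'
  rw [Jac_rot]
  refine key _ _ (fun g hg => ?_) j hj hj'
  rw [Jac_rot]
  refine key _ _ (fun h hh => ?_) k hk hk'
  exact T.jac_gen H hm hh hf hg
end

/-! ### The ring of smooth functions on the open set -/
namespace SmoothRing
open scoped ContDiff

/-- The open set where no coordinate vanishes. -/
def U (n : ℕ) : Set (Fin n → ℝ) := {y | ∀ i, y i ≠ 0}

theorem isOpen_U (n : ℕ) : IsOpen (U n) := by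
  have : U n = ⋂ i : Fin n, {y | y i ≠ 0} := by ext y; simp [U]
  rw [this]
  exact isOpen_iInter_of_finite fun i => isOpen_ne_fun (continuous_apply i) continuous_const

open Classical in
/-- Extension by zero. -/
noncomputable def ext0 {n : ℕ} (f : U n → ℝ) : (Fin n → ℝ) → ℝ :=
  fun y => if h : y ∈ U n then f ⟨y, h⟩ else 0

theorem ext0_apply {n : ℕ} (f : U n → ℝ) (u : U n) : ext0 f u = f u := by
  simp [ext0]

theorem ext0_restrict {n : ℕ} (F : (Fin n → ℝ) → ℝ) : Set.EqOn (ext0 (fun u : U n => F u)) F (U n) := by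
  intro y hy
  exact ext0_apply (fun u : U n => F u) ⟨y, hy⟩

/-- Smooth functions on `U n`. -/
noncomputable def S (n : ℕ) : Subalgebra ℝ (U n → ℝ) where
  carrier := {f | ContDiffOn ℝ ∞ (ext0 f) (U n)}
  mul_mem' := by
    intro f g hf hg
    refine (ContDiffOn.mul hf hg).congr fun y hy => ?_
    exact (ext0_apply (f * g) ⟨y, hy⟩).trans
      (by simp [ext0, hy])
  add_mem' := by
    intro f g hf hg
    refine (ContDiffOn.add hf hg).congr fun y hy => ?_
    exact (ext0_apply (f + g) ⟨y, hy⟩).trans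
      (by simp [ext0, hy])
  algebraMap_mem' := by
    intro r
    exact (contDiffOn_const (c := r)).congr fun y hy => ext0_restrict (fun _ => r) hy

/-- Restriction of a smooth function. -/
noncomputable def mk {n : ℕ} (F : (Fin n → ℝ) → ℝ) (hF : ContDiffOn ℝ ∞ F (U n)) : S n :=
  ⟨fun u => F u, hF.congr (ext0_restrict F)⟩

theorem mk_apply {n : ℕ} (F : (Fin n → ℝ) → ℝ) (hF : ContDiffOn ℝ ∞ F (U n)) (u : U n) :
    (mk F hF).1 u = F u := rfl

/-- Partial derivative. -/
noncomputable def pd {n : ℕ} (l : Fin n) (f : S n) : S n :=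
  mk (fun y => fderiv ℝ (ext0 f.1) y (Pi.single l 1)) (by
    have h : ContDiffOn ℝ ∞ (ext0 f.1) (U n) := f.2
    have h2 : ContDiffOn ℝ ∞ (fderiv ℝ (ext0 f.1)) (U n) :=
      h.fderiv_of_isOpen (isOpen_U n) (by simp)
    exact h2.clm_apply contDiffOn_const)

theorem pd_mk {n : ℕ} (l : Fin n) (F : (Fin n → ℝ) → ℝ) (hF : ContDiffOn ℝ ∞ F (U n)) (u : U n) :
    (pd l (mk F hF)).1 u = fderiv ℝ F u (Pi.single l 1) := by
  have : ext0 (mk F hF).1 =ᶠ[nhds (u : Fin n → ℝ)] F :=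
    (ext0_restrict F).eventuallyEq_of_mem ((isOpen_U n).mem_nhds u.2)
  change fderiv ℝ (ext0 (mk F hF).1) u (Pi.single l 1) = _
  rw [this.fderiv_eq]

theorem diffAt {n : ℕ} (f : S n) (u : U n) : DifferentiableAt ℝ (ext0 f.1) u := by
  have h : ContDiffOn ℝ ∞ (ext0 f.1) (U n) := f.2
  exact (h.contDiffAt ((isOpen_U n).mem_nhds u.2)).differentiableAt (by simp)

theorem eq_mk {n : ℕ} (f : S n) : f = mk (ext0 f.1) f.2 := by
  apply Subtype.ext; funext u; exact (ext0_apply f.1 u).symm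

theorem pd_add {n : ℕ} (l : Fin n) (f g : S n) : pd l (f + g) = pd l f + pd l g := by
  have e : f + g = mk (ext0 f.1 + ext0 g.1) (ContDiffOn.add f.2 g.2) := by
    apply Subtype.ext; funext u
    change f.1 u + g.1 u = ext0 f.1 u + ext0 g.1 u
    rw [ext0_apply, ext0_apply]
  apply Subtype.ext; funext u
  rw [e, pd_mk, fderiv_add (diffAt f u) (diffAt g u)]
  rfl

theorem pd_mul {n : ℕ} (l : Fin n) (f g : S n) : pd l (f * g) = f * pd l g + g * pd l f := by
  have e : f * g = mk (ext0 f.1 * ext0 g.1) (ContDiffOn.mul f.2 g.2) := by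
    apply Subtype.ext; funext u
    change f.1 u * g.1 u = ext0 f.1 u * ext0 g.1 u
    rw [ext0_apply, ext0_apply]
  apply Subtype.ext; funext u
  rw [e, pd_mk, fderiv_mul (diffAt f u) (diffAt g u), ext0_apply, ext0_apply]
  rfl

/-- The bracket of a bivector. -/
noncomputable def brS {n : ℕ} (ρ : Fin n → Fin n → S n) (f g : S n) : S n :=
  ∑ l, ∑ k, ρ l k * pd l f * pd k g

theorem skewBr {n : ℕ} (ρ : Fin n → Fin n → S n) (hρ : ∀ l k, ρ l k = - ρ k l) :
    SkewBr (brS ρ) := by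
  have sk : ∀ f g, brS ρ f g = - brS ρ g f := by
    intro f g
    unfold brS
    rw [Finset.sum_comm, ← Finset.sum_neg_distrib]
    refine Finset.sum_congr rfl fun l _ => ?_
    rw [← Finset.sum_neg_distrib]
    refine Finset.sum_congr rfl fun k _ => ?_
    rw [hρ]; ring
  refine ⟨?_, sk, ?_, ?_⟩
  · intro f
    have h := sk f f
    apply Subtype.ext; funext u
    have h2 : (brS ρ f f).1 u = - (brS ρ f f).1 u := congrFun (congrArg Subtype.val h) u
    change (brS ρ f f).1 u = 0
    linarith
  · intro f g h
    unfold brS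
    simp only [pd_add, ← Finset.sum_add_distrib]
    refine Finset.sum_congr rfl fun l _ => Finset.sum_congr rfl fun k _ => ?_
    ring
  · intro f g h
    unfold brS
    simp only [pd_mul, Finset.mul_sum, ← Finset.sum_add_distrib]
    refine Finset.sum_congr rfl fun l _ => Finset.sum_congr rfl fun k _ => ?_
    ring

/-- Coordinates. -/
noncomputable def X {n : ℕ} (i : Fin n) : S n := mk (fun y => y i) (contDiff_apply ℝ ℝ i).contDiffOn

theorem pd_X {n : ℕ} (l i : Fin n) : pd l (X i) = if l = i then 1 else 0 := by
  apply Subtype.ext; funext u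
  rw [X, pd_mk]
  have : fderiv ℝ (fun y : Fin n → ℝ => y i) u = ContinuousLinearMap.proj i :=
    (ContinuousLinearMap.proj (R := ℝ) (φ := fun _ : Fin n => ℝ) i).fderiv
  rw [this]
  by_cases h : l = i
  · subst h; simp
  · rw [if_neg h]
    change (Pi.single l (1 : ℝ) : Fin n → ℝ) i = 0
    rw [Pi.single_eq_of_ne (Ne.symm h)]

theorem brS_X {n : ℕ} (ρ : Fin n → Fin n → S n) (f : S n) (i : Fin n) :
    brS ρ f (X i) = ∑ l, ρ l i * pd l f := by
  unfold brS
  simp [pd_X]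

theorem brS_XX {n : ℕ} (ρ : Fin n → Fin n → S n) (i j : Fin n) :
    brS ρ (X i) (X j) = ρ i j := by
  rw [brS_X]
  simp [pd_X]

theorem brS_add {n : ℕ} (ρ σ : Fin n → Fin n → S n) (f g : S n) :
    brS (fun l k => ρ l k + σ l k) f g = brS ρ f g + brS σ f g := by
  unfold brS
  simp only [← Finset.sum_add_distrib, add_mul]

end SmoothRing

namespace Inst
open SmoothRing
open scoped ContDiff

theorem contDiff_coord (n i : ℕ) : ContDiff ℝ ∞ (fun y : Fin n → ℝ => coord n y i) := by
  unfold coord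
  split_ifs with h
  · exact contDiff_apply ℝ ℝ _
  · exact contDiff_const

theorem coord_ne (n i : ℕ) (h1 : 1 ≤ i) (h2 : i ≤ n) (y : Fin n → ℝ) (hy : y ∈ U n) :
    coord n y i ≠ 0 := by
  unfold coord
  rw [dif_pos ⟨h1, h2⟩]
  exact hy _

theorem contDiffOn_tau (n i j : ℕ) : ContDiffOn ℝ ∞ (fun y : Fin n → ℝ => tauD n y i j) (U n) := by
  unfold tauD
  refine (contDiff_coord n _).contDiffOn.mul (contDiffOn_prod fun k _ => ?_)
  by_cases h : 1 ≤ 2 * k ∧ 2 * k ≤ n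
  · exact (contDiff_coord n _).contDiffOn.div (contDiff_coord n _).contDiffOn
      (fun y hy => coord_ne n _ h.1 h.2 y hy)
  · have : (fun y : Fin n → ℝ => coord n y (2 * k + 1) / coord n y (2 * k)) = fun _ => 0 := by
      funext y
      have : coord n y (2 * k) = 0 := by unfold coord; rw [dif_neg h]
      rw [this, div_zero]
    rw [this]
    exact contDiffOn_const

theorem contDiffOn_pi1 (n i j : ℕ) : ContDiffOn ℝ ∞ (fun y : Fin n → ℝ => pi1 n y i j) (U n) := by
  have hB : ∀ i j, ContDiffOn ℝ ∞ (fun y : Fin n → ℝ => pi1B n y i j) (U n) := by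
    intro i j
    unfold pi1B
    split_ifs
    · exact contDiffOn_const.mul (contDiffOn_tau n _ _)
    · exact contDiffOn_const.mul (contDiffOn_tau n _ _)
    · exact contDiffOn_const.mul ((contDiff_coord n _).sub (contDiff_coord n _)).contDiffOn
    · exact contDiffOn_const
  unfold pi1
  split_ifs
  · exact hB i j
  · exact (hB j i).neg
  · exact contDiffOn_const

theorem contDiffOn_pi3 (n i j : ℕ) : ContDiffOn ℝ ∞ (fun y : Fin n → ℝ => pi3 n y i j) (U n) := by
  have hc := contDiff_coord n
  have hB : ∀ i j, ContDiff ℝ ∞ (fun y : Fin n → ℝ => pi3B n y i j) := by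
    intro i j
    unfold pi3B
    split_ifs
    · exact ((hc _).mul (hc _)).mul ((contDiff_const.mul (hc _)).add (hc _))
    · exact ((hc _).mul (hc _)).mul ((hc _).add (hc _))
    · exact ((hc _).mul (hc _)).mul ((contDiff_const.mul (hc _)).add (hc _))
    · exact ((contDiff_const.mul (hc _)).mul (hc _)).mul ((hc _).sub (hc _))
    · exact ((hc _).mul (hc _)).mul (hc _)
    · exact ((hc _).mul (hc _)).mul ((hc _).add (contDiff_const.mul (hc _)))
    · exact ((hc _).mul (hc _)).mul (hc _)
    · exact contDiff_const
  unfold pi3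
  split_ifs
  · exact (hB i j).contDiffOn
  · exact (hB j i).contDiffOn.neg
  · exact contDiffOn_const

/-- Entries of `π₁` as smooth functions. -/
noncomputable def P1 (n i j : ℕ) : S n := mk (fun y => pi1 n y i j) (contDiffOn_pi1 n i j)
/-- Entries of `π₃` as smooth functions. -/
noncomputable def P3 (n i j : ℕ) : S n := mk (fun y => pi3 n y i j) (contDiffOn_pi3 n i j)
/-- Coordinates as smooth functions. -/
noncomputable def v (n i : ℕ) : S n := mk (fun y => coord n y i) (contDiff_coord n i).contDiffOn
/-- The bracket of `π₁`. -/
noncomputable def br1 (n : ℕ) : S n → S n → S n := brS fun l k : Fin n => P1 n (l + 1) (k + 1)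
/-- The bracket of `π₃`. -/
noncomputable def br3 (n : ℕ) : S n → S n → S n := brS fun l k : Fin n => P3 n (l + 1) (k + 1)
/-- The bracket of the sum. -/
noncomputable def br (n : ℕ) : S n → S n → S n :=
  brS fun l k : Fin n => P1 n (l + 1) (k + 1) + P3 n (l + 1) (k + 1)

theorem P1_skew (n i j : ℕ) : P1 n i j = - P1 n j i := by
  apply Subtype.ext; funext u
  change pi1 n u i j = - pi1 n u j i
  unfold pi1
  split_ifs <;> first | omega | simp

theorem P3_skew (n i j : ℕ) : P3 n i j = - P3 n j i := by
  apply Subtype.ext; funext u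
  change pi3 n u i j = - pi3 n u j i
  unfold pi3
  split_ifs <;> first | omega | simp

theorem H1 (n : ℕ) : SkewBr (br1 n) := skewBr _ fun _ _ => P1_skew _ _ _
theorem H3 (n : ℕ) : SkewBr (br3 n) := skewBr _ fun _ _ => P3_skew _ _ _
theorem H (n : ℕ) : SkewBr (br n) := skewBr _ fun l k => by
  rw [P1_skew n (l + 1), P3_skew n (l + 1)]; ring

theorem v_eq (n i : ℕ) (h1 : 1 ≤ i) (h2 : i ≤ n) : v n i = X ⟨i - 1, by omega⟩ := by
  apply Subtype.ext; funext u
  change coord n u i = u.1 _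
  unfold coord
  rw [dif_pos ⟨h1, h2⟩]

theorem br1_v (n i j : ℕ) (hi : 1 ≤ i) (hi' : i ≤ n) (hj : 1 ≤ j) (hj' : j ≤ n) :
    br1 n (v n i) (v n j) = P1 n i j := by
  rw [v_eq n i hi hi', v_eq n j hj hj', br1, brS_XX]
  simp only [Nat.sub_add_cancel hi, Nat.sub_add_cancel hj]

theorem br3_v (n i j : ℕ) (hi : 1 ≤ i) (hi' : i ≤ n) (hj : 1 ≤ j) (hj' : j ≤ n) :
    br3 n (v n i) (v n j) = P3 n i j := by
  rw [v_eq n i hi hi', v_eq n j hj hj', br3, brS_XX]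
  simp only [Nat.sub_add_cancel hi, Nat.sub_add_cancel hj]

/-- Modified Volterra coordinates. -/
noncomputable def V (m i : ℕ) : S (2 * m + 1) :=
  if i = 2 * m then v (2 * m + 1) (2 * m) + v (2 * m + 1) (2 * m + 1) else v (2 * m + 1) i
/-- The difference of the last two coordinates. -/
noncomputable def d (m : ℕ) : S (2 * m + 1) := v (2 * m + 1) (2 * m + 1) - v (2 * m + 1) (2 * m)
/-- Toda coordinates `a`. -/
noncomputable def a (m p : ℕ) : S (2 * m + 1) :=
  if p = 0 then V m 1 else if p = m then d m else V m (2 * p) * V m (2 * p + 1)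
/-- Toda coordinates `b`. -/
noncomputable def b (m p : ℕ) : S (2 * m + 1) := V m (2 * p - 1) + V m (2 * p)

theorem chg (m : ℕ) (hm : 2 ≤ m) : Chg m (V m) (d m) (a m) (b m) := by
  refine ⟨by simp [a], ?_, ?_, ?_⟩
  · intro p hp
    rw [a, if_neg (by omega), if_pos hp]
  · intro p h1 h2
    rw [a, if_neg (by omega), if_neg (by omega)]
  · intro p
    rw [b, show 2 * (p + 1) - 1 = 2 * p + 1 by omega, show 2 * (p + 1) = 2 * p + 2 by ring]

/-- Scaled `τ` as a smooth function. -/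
noncomputable def tau (n i j : ℕ) : S n :=
  mk (fun y => (-1 : ℝ) ^ (i + j - 1) * tauD n y (i / 2 + 1) ((j + 1) / 2))
    (contDiffOn_const.mul (contDiffOn_tau n _ _))

theorem P1_tau (m i j : ℕ) (h1 : 1 ≤ i) (h2 : i < j) (h3 : j < 2 * m) :
    P1 (2 * m + 1) i j = tau (2 * m + 1) i j := by
  apply Subtype.ext; funext u
  change pi1 (2 * m + 1) u i j = _
  rw [pi1, if_pos h2, pi1B, if_pos (by omega)]
  rfl

theorem P1_last (m i : ℕ) (h1 : 1 ≤ i) (h2 : i < 2 * m) :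
    P1 (2 * m + 1) i (2 * m + 1) = P1 (2 * m + 1) i (2 * m) := by
  apply Subtype.ext; funext u
  change pi1 (2 * m + 1) u i (2 * m + 1) = pi1 (2 * m + 1) u i (2 * m)
  rw [pi1, pi1, if_pos (by omega), if_pos (by omega), pi1B, pi1B, if_neg (by omega),
    if_pos (by omega), if_neg (by omega), if_pos (by omega)]

theorem P1_last2 (m i : ℕ) (h1 : 1 ≤ i) (h2 : i < 2 * m) :
    P1 (2 * m + 1) i (2 * m) + P1 (2 * m + 1) i (2 * m) = tau (2 * m + 1) i (2 * m) := by
  apply Subtype.ext; funext u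
  change pi1 (2 * m + 1) u i (2 * m) + pi1 (2 * m + 1) u i (2 * m) = (-1 : ℝ) ^ (i + 2 * m - 1) *
    tauD (2 * m + 1) u (i / 2 + 1) ((2 * m + 1) / 2)
  rw [pi1, if_pos (by omega), pi1B, if_neg (by omega), if_pos (by omega)]
  rw [show i + (2 * m + 1) = (i + 2 * m - 1) + 2 by omega, pow_add]
  ring

theorem br1_V (m i j : ℕ) (h1 : 1 ≤ i) (h2 : i < j) (h3 : j ≤ 2 * m) :
    br1 (2 * m + 1) (V m i) (V m j) = tau (2 * m + 1) i j := by
  rw [V, if_neg (by omega), V]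
  split_ifs with e
  · subst e
    rw [(H1 _).add_r, br1_v _ _ _ h1 (by omega) (by omega) (by omega),
      br1_v _ _ _ h1 (by omega) (by omega) (by omega), P1_last m i h1 h2, P1_last2 m i h1 h2]
  · rw [br1_v _ _ _ h1 (by omega) (by omega) (by omega), P1_tau m i j h1 h2 (by omega)]

theorem V_lt (m i : ℕ) (h : i < 2 * m) : V m i = v (2 * m + 1) i := by
  rw [V, if_neg (by omega)]
theorem V_last (m : ℕ) : V m (2 * m) = v (2 * m + 1) (2 * m) + v (2 * m + 1) (2 * m + 1) := by
  rw [V, if_pos rfl]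

theorem vtab1 (m : ℕ) (hm : 2 ≤ m) : VTab1 (br1 (2 * m + 1)) m (V m) (d m) := by
  refine ⟨?_, ?_, ?_, ?_, ?_, ?_⟩
  · intro i q h1 h2 h3
    rw [br1_V m _ _ h1 h2 (by omega), br1_V m _ _ h1 (by omega) (by omega)]
    apply Subtype.ext; funext u
    change (-1 : ℝ) ^ (i + (2 * q + 1) - 1) * tauD (2 * m + 1) u (i / 2 + 1) ((2 * q + 1 + 1) / 2) +
      (-1 : ℝ) ^ (i + (2 * q + 2) - 1) * tauD (2 * m + 1) u (i / 2 + 1) ((2 * q + 2 + 1) / 2) = 0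
    rw [show (2 * q + 1 + 1) / 2 = q + 1 by omega, show (2 * q + 2 + 1) / 2 = q + 1 by omega,
      show i + (2 * q + 2) - 1 = (i + (2 * q + 1) - 1) + 1 by omega, pow_succ]
    ring
  · intro i q h1 h2 h3
    rw [br1_V m _ _ h1 h2 (by omega), br1_V m _ _ h1 (by omega) (by omega),
      V_lt m _ (by omega), V_lt m _ (by omega)]
    apply Subtype.ext; funext u
    change coord (2 * m + 1) u (2 * q + 1) *
      ((-1 : ℝ) ^ (i + 2 * q - 1) * tauD (2 * m + 1) u (i / 2 + 1) ((2 * q + 1) / 2)) +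
      coord (2 * m + 1) u (2 * q) *
      ((-1 : ℝ) ^ (i + (2 * q + 1) - 1) * tauD (2 * m + 1) u (i / 2 + 1) ((2 * q + 1 + 1) / 2)) = 0
    have hne := coord_ne (2 * m + 1) (2 * q) (by omega) (by omega) u u.2
    rw [show (2 * q + 1 + 1) / 2 = q + 1 by omega, show (2 * q + 1) / 2 = q by omega,
      show i + (2 * q + 1) - 1 = (i + 2 * q - 1) + 1 by omega, pow_succ, tauD, tauD,
      Finset.prod_Ico_succ_top (by omega)]
    field_simp
    ring
  · intro q h1
    rw [br1_V m _ _ (by omega) (by omega) (by omega), V_lt m _ (by omega)]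
    apply Subtype.ext; funext u
    change (-1 : ℝ) ^ (2 * q + 1 + (2 * q + 2) - 1) *
      tauD (2 * m + 1) u ((2 * q + 1) / 2 + 1) ((2 * q + 2 + 1) / 2) = coord (2 * m + 1) u (2 * q + 1)
    rw [show 2 * q + 1 + (2 * q + 2) - 1 = 2 * (2 * q + 1) by omega, pow_mul,
      show (2 * q + 1) / 2 + 1 = q + 1 by omega, show (2 * q + 2 + 1) / 2 = q + 1 by omega, tauD,
      show 2 * (q + 1) - 1 = 2 * q + 1 by omega]
    simp
  · intro q h0 h1
    rw [br1_V m _ _ (by omega) (by omega) (by omega), V_lt m _ (by omega)]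
    apply Subtype.ext; funext u
    change (-1 : ℝ) ^ (2 * q + (2 * q + 1) - 1) *
      tauD (2 * m + 1) u ((2 * q) / 2 + 1) ((2 * q + 1 + 1) / 2) = coord (2 * m + 1) u (2 * q + 1)
    rw [show 2 * q + (2 * q + 1) - 1 = 2 * (2 * q) by omega, pow_mul,
      show (2 * q) / 2 + 1 = q + 1 by omega, show (2 * q + 1 + 1) / 2 = q + 1 by omega, tauD,
      show 2 * (q + 1) - 1 = 2 * q + 1 by omega]
    simp
  · intro i h1 h2
    rw [V_lt m _ h2, d, (H1 _).sub_r, br1_v _ _ _ h1 (by omega) (by omega) (by omega),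
      br1_v _ _ _ h1 (by omega) (by omega) (by omega), P1_last m i h1 h2, sub_self]
  · rw [V_last, d, (H1 _).sub_r, (H1 _).add, (H1 _).add, (H1 _).self, (H1 _).self,
      (H1 _).skew (v _ (2 * m + 1)), br1_v _ _ _ (by omega) (by omega) (by omega) (by omega)]
    apply Subtype.ext; funext u
    change pi1 (2 * m + 1) u (2 * m) (2 * m + 1) + 0 - (0 + - pi1 (2 * m + 1) u (2 * m) (2 * m + 1)) =
      coord (2 * m + 1) u (2 * m + 1) - coord (2 * m + 1) u (2 * m)
    rw [pi1, if_pos (by omega), pi1B, if_neg (by omega), if_neg (by omega), if_pos (by omega),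
      show 2 * m + 1 - 1 = 2 * m by omega]
    ring

theorem p3a (m : ℕ) (hm : 2 ≤ m)  :
    P3 (2 * m + 1) 1 2 = v (2 * m + 1) 1 * v (2 * m + 1) 2 * (v (2 * m + 1) 1 + v (2 * m + 1) 1 + v (2 * m + 1) 2) := by
  apply Subtype.ext; funext u
  change pi3 (2 * m + 1) u 1 2 = coord (2 * m + 1) u 1 * coord (2 * m + 1) u 2 * (coord (2 * m + 1) u 1 + coord (2 * m + 1) u 1 + coord (2 * m + 1) u 2)
  rw [pi3, if_pos (by omega), pi3B, if_pos (by omega)]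
  ring

theorem p3b (m : ℕ) (hm : 2 ≤ m) (i : ℕ) (h : 2 ≤ i) (h2 : i + 1 < 2 * m) :
    P3 (2 * m + 1) i (i + 1) = v (2 * m + 1) i * v (2 * m + 1) (i + 1) * (v (2 * m + 1) i + v (2 * m + 1) (i + 1)) := by
  apply Subtype.ext; funext u
  change pi3 (2 * m + 1) u i (i + 1) = coord (2 * m + 1) u i * coord (2 * m + 1) u (i + 1) * (coord (2 * m + 1) u i + coord (2 * m + 1) u (i + 1))
  rw [pi3, if_pos (by omega), pi3B, if_neg (by omega), if_pos (by omega)]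

theorem p3c (m : ℕ) (hm : 2 ≤ m) (i : ℕ) (h : i + 1 = 2 * m) :
    P3 (2 * m + 1) i (2 * m) = v (2 * m + 1) i * v (2 * m + 1) (2 * m) * (v (2 * m + 1) (2 * m) + v (2 * m + 1) (2 * m) + v (2 * m + 1) i) := by
  apply Subtype.ext; funext u
  change pi3 (2 * m + 1) u i (2 * m) = coord (2 * m + 1) u i * coord (2 * m + 1) u (2 * m) * (coord (2 * m + 1) u (2 * m) + coord (2 * m + 1) u (2 * m) + coord (2 * m + 1) u i)
  rw [pi3, if_pos (by omega), pi3B, if_neg (by omega), if_neg (by omega), if_pos (by omega)]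
  rw [show 2 * m + 1 - 2 = i by omega, show 2 * m + 1 - 1 = 2 * m by omega]
  ring

theorem p3d (m : ℕ) (hm : 2 ≤ m)  :
    P3 (2 * m + 1) (2 * m) (2 * m + 1) = (v (2 * m + 1) (2 * m) * v (2 * m + 1) (2 * m + 1) + v (2 * m + 1) (2 * m) * v (2 * m + 1) (2 * m + 1)) * (v (2 * m + 1) (2 * m + 1) - v (2 * m + 1) (2 * m)) := by
  apply Subtype.ext; funext u
  change pi3 (2 * m + 1) u (2 * m) (2 * m + 1) = (coord (2 * m + 1) u (2 * m) * coord (2 * m + 1) u (2 * m + 1) + coord (2 * m + 1) u (2 * m) * coord (2 * m + 1) u (2 * m + 1)) * (coord (2 * m + 1) u (2 * m + 1) - coord (2 * m + 1) u (2 * m))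
  rw [pi3, if_pos (by omega), pi3B, if_neg (by omega), if_neg (by omega), if_neg (by omega), if_pos (by omega)]
  rw [show 2 * m + 1 - 1 = 2 * m by omega]
  ring

theorem p3e (m : ℕ) (hm : 2 ≤ m) (i : ℕ) (h : 1 ≤ i) (h2 : i + 2 ≤ 2 * m) :
    P3 (2 * m + 1) i (i + 2) = v (2 * m + 1) i * v (2 * m + 1) (i + 1) * v (2 * m + 1) (i + 2) := by
  apply Subtype.ext; funext u
  change pi3 (2 * m + 1) u i (i + 2) = coord (2 * m + 1) u i * coord (2 * m + 1) u (i + 1) * coord (2 * m + 1) u (i + 2)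
  rw [pi3, if_pos (by omega), pi3B, if_neg (by omega), if_neg (by omega), if_neg (by omega), if_neg (by omega), if_pos (by omega)]

theorem p3f (m : ℕ) (hm : 2 ≤ m) (i : ℕ) (h : i + 1 = 2 * m) :
    P3 (2 * m + 1) i (2 * m + 1) = v (2 * m + 1) i * v (2 * m + 1) (2 * m + 1) * (v (2 * m + 1) i + (v (2 * m + 1) (2 * m + 1) + v (2 * m + 1) (2 * m + 1))) := by
  apply Subtype.ext; funext u
  change pi3 (2 * m + 1) u i (2 * m + 1) = coord (2 * m + 1) u i * coord (2 * m + 1) u (2 * m + 1) * (coord (2 * m + 1) u i + (coord (2 * m + 1) u (2 * m + 1) + coord (2 * m + 1) u (2 * m + 1)))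
  rw [pi3, if_pos (by omega), pi3B, if_neg (by omega), if_neg (by omega), if_neg (by omega), if_neg (by omega), if_neg (by omega), if_pos (by omega)]
  rw [show 2 * m + 1 - 2 = i by omega]
  ring

theorem p3g (m : ℕ) (hm : 2 ≤ m) (i : ℕ) (h : i + 2 = 2 * m) :
    P3 (2 * m + 1) i (2 * m + 1) = v (2 * m + 1) i * v (2 * m + 1) (i + 1) * v (2 * m + 1) (2 * m + 1) := by
  apply Subtype.ext; funext u
  change pi3 (2 * m + 1) u i (2 * m + 1) = coord (2 * m + 1) u i * coord (2 * m + 1) u (i + 1) * coord (2 * m + 1) u (2 * m + 1)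
  rw [pi3, if_pos (by omega), pi3B, if_neg (by omega), if_neg (by omega), if_neg (by omega), if_neg (by omega), if_neg (by omega), if_neg (by omega), if_pos (by omega)]
  rw [show 2 * m + 1 - 3 = i by omega, show 2 * m + 1 - 2 = i + 1 by omega]

theorem p3z (m : ℕ) (hm : 2 ≤ m) (i j : ℕ) (h : 1 ≤ i) (h1 : i + 2 < j) (h2 : j ≤ 2 * m ∨ i + 2 < 2 * m) :
    P3 (2 * m + 1) i j = 0 := by
  apply Subtype.ext; funext u
  change pi3 (2 * m + 1) u i j = 0
  rw [pi3, if_pos (by omega), pi3B, if_neg (by omega), if_neg (by omega), if_neg (by omega), if_neg (by omega), if_neg (by omega), if_neg (by omega), if_neg (by omega)]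

theorem vtab3 (m : ℕ) (hm : 2 ≤ m) : VTab3 (br3 (2 * m + 1)) m (V m) (d m) := by
  have B : ∀ i j, 1 ≤ i → i ≤ 2 * m + 1 → 1 ≤ j → j ≤ 2 * m + 1 →
      br3 (2 * m + 1) (v (2 * m + 1) i) (v (2 * m + 1) j) = P3 (2 * m + 1) i j :=
    br3_v (2 * m + 1)
  refine ⟨?_, ?_, ?_, ?_, ?_, ?_, ?_, ?_, ?_⟩
  · rintro i j rfl rfl
    rw [V_lt m _ (by omega), V_lt m _ (by omega), B _ _ (by omega) (by omega) (by omega) (by omega),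
      p3a m hm]
    ring
  · rintro i j h1 h2 rfl
    rw [V_lt m _ (by omega), V_lt m _ (by omega), B _ _ (by omega) (by omega) (by omega) (by omega),
      p3b m hm i h1 h2]
  · rintro i j rfl h
    rw [V_lt m _ (by omega), V_last, (H3 _).add_r, B _ _ (by omega) (by omega) (by omega) (by omega),
      B _ _ (by omega) (by omega) (by omega) (by omega), p3c m hm i h.symm, p3f m hm i h.symm, d]
    ring
  · rintro i j h1 h2 rfl
    rw [V_lt m i (by omega), V_lt m (i + 1) (by omega)]
    rcases h2.lt_or_eq with h | h
    · rw [V_lt m _ h, B _ _ (by omega) (by omega) (by omega) (by omega), p3e m hm i h1 h2]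
    · have e := p3e m hm i h1 h2
      rw [h] at e ⊢
      rw [V_last, (H3 _).add_r, B _ _ (by omega) (by omega) (by omega) (by omega),
        B _ _ (by omega) (by omega) (by omega) (by omega), e, p3g m hm i h]
      ring
  · intro i j h1 h2 h3
    rw [V_lt m i (by omega)]
    rcases h2.lt_or_eq with h | h
    · rw [V_lt m _ h, B _ _ (by omega) (by omega) (by omega) (by omega),
        p3z m hm i j h1 h3 (by omega)]
    · subst h
      rw [V_last, (H3 _).add_r, B _ _ (by omega) (by omega) (by omega) (by omega),
        B _ _ (by omega) (by omega) (by omega) (by omega), p3z m hm i _ h1 h3 (by omega),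
        p3z m hm i _ h1 (by omega) (by omega), add_zero]
  · intro i h1 h2
    rw [V_lt m i (by omega), d, (H3 _).sub_r, B _ _ (by omega) (by omega) (by omega) (by omega),
      B _ _ (by omega) (by omega) (by omega) (by omega), p3z m hm i _ h1 (by omega) (by omega),
      p3z m hm i _ h1 (by omega) (by omega), sub_zero]
  · intro i h
    have e := p3e m hm i (by omega) (by omega)
    rw [h] at e
    rw [V_lt m i (by omega), V_lt m (i + 1) (by omega), d, (H3 _).sub_r,
      B _ _ (by omega) (by omega) (by omega) (by omega),
      B _ _ (by omega) (by omega) (by omega) (by omega), e, p3g m hm i h]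
    ring
  · intro i h
    rw [h, V_lt m i (by omega), V_last, d, (H3 _).sub_r,
      B _ _ (by omega) (by omega) (by omega) (by omega),
      B _ _ (by omega) (by omega) (by omega) (by omega), p3c m hm i h, p3f m hm i h]
    ring
  · rintro i rfl
    rw [V_last, d, (H3 _).sub_r, (H3 _).add, (H3 _).add, (H3 _).self, (H3 _).self,
      (H3 _).skew (v _ (2 * m + 1)), B _ _ (by omega) (by omega) (by omega) (by omega), p3d m hm]
    ring

theorem isUnit_v (m i : ℕ) (h1 : 1 ≤ i) (h2 : i ≤ 2 * m + 1) : IsUnit (v (2 * m + 1) i) := by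
  refine IsUnit.of_mul_eq_one (mk (fun y => (coord (2 * m + 1) y i)⁻¹)
    ((contDiff_coord _ i).contDiffOn.inv fun y hy => coord_ne _ i h1 h2 y hy)) ?_
  apply Subtype.ext; funext u
  exact mul_inv_cancel₀ (coord_ne _ i h1 h2 u u.2)

theorem isUnit_two (n : ℕ) : IsUnit (2 : S n) := by
  have h : IsUnit (algebraMap ℝ (S n) 2) := (isUnit_iff_ne_zero.2 two_ne_zero).map _
  rwa [map_ofNat] at h

theorem jac (m : ℕ) (hm : 2 ≤ m) (i j k : ℕ) (hi1 : 1 ≤ i) (hi2 : i ≤ 2 * m + 1) (hj1 : 1 ≤ j)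
    (hj2 : j ≤ 2 * m + 1) (hk1 : 1 ≤ k) (hk2 : k ≤ 2 * m + 1) :
    SkewBr.Jac (br (2 * m + 1)) (v (2 * m + 1) i) (v (2 * m + 1) j) (v (2 * m + 1) k) = 0 := by
  refine jac_v (H _) hm (todaTab (H3 _) hm (linTab (H1 _) hm (vtab1 m hm) (chg m hm)) (vtab3 m hm)
    (chg m hm) (fun f g => brS_add _ _ f g)) (chg m hm) ?_ (isUnit_two _) (v (2 * m + 1))
    (fun i _ h => (V_lt m i h).symm) (V_last m) rfl i j k hi1 hi2 hj1 hj2 hk1 hk2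
  intro p h1 h2
  rw [V_lt m _ (by omega)]
  exact isUnit_v m _ (by omega) (by omega)

/-- The entries of the sum. -/
noncomputable def P (n i j : ℕ) : S n :=
  mk (fun y => pi1 n y i j + pi3 n y i j) ((contDiffOn_pi1 n i j).add (contDiffOn_pi3 n i j))

theorem br_v (n i j : ℕ) (hi : 1 ≤ i) (hi' : i ≤ n) (hj : 1 ≤ j) (hj' : j ≤ n) :
    br n (v n i) (v n j) = P n i j := by
  rw [v_eq n i hi hi', v_eq n j hj hj', br, brS_XX]
  simp only [Nat.sub_add_cancel hi, Nat.sub_add_cancel hj]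
  rfl

theorem br_P (n i j k : ℕ) (hi : 1 ≤ i) (hi' : i ≤ n) (u : U n) :
    (br n (P n j k) (v n i)).1 u = ∑ l : Fin n, (pi1 n u ((l : ℕ) + 1) i + pi3 n u ((l : ℕ) + 1) i) *
      fderiv ℝ (fun y => pi1 n y j k + pi3 n y j k) u (Pi.single l 1) := by
  rw [v_eq n i hi hi', br, brS_X]
  have e : ∀ f : S n, f.1 u = ((Pi.evalRingHom (fun _ : U n => ℝ) u).comp (S n).val.toRingHom) f :=
    fun _ => rfl
  rw [e, map_sum]
  refine Finset.sum_congr rfl fun l _ => ?_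
  rw [map_mul, ← e, ← e, P, pd_mk]
  simp only [Nat.sub_add_cancel hi]
  rfl

end Inst

/-- for odd `n = 2m+1 ≥ 5`, the Poisson tensors `π₁` and `π₃` are compatible:
their sum satisfies the Jacobi identity on the open set where all coordinates are nonzero. -/
theorem pi1_pi3_compatible (m : ℕ) (hm : 2 ≤ m) (x : Fin (2*m+1) → ℝ)
    (hx : ∀ i, x i ≠ 0)
    (i j k : ℕ) (hi1 : 1 ≤ i) (hi2 : i ≤ 2*m+1) (hj1 : 1 ≤ j) (hj2 : j ≤ 2*m+1)
    (hk1 : 1 ≤ k) (hk2 : k ≤ 2*m+1) :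
    ∑ l : Fin (2*m+1),
      ((pi1 (2*m+1) x ((l : ℕ) + 1) i + pi3 (2*m+1) x ((l : ℕ) + 1) i) *
          fderiv ℝ (fun y => pi1 (2*m+1) y j k + pi3 (2*m+1) y j k) x (Pi.single l 1)
        + (pi1 (2*m+1) x ((l : ℕ) + 1) j + pi3 (2*m+1) x ((l : ℕ) + 1) j) *
          fderiv ℝ (fun y => pi1 (2*m+1) y k i + pi3 (2*m+1) y k i) x (Pi.single l 1)
        + (pi1 (2*m+1) x ((l : ℕ) + 1) k + pi3 (2*m+1) x ((l : ℕ) + 1) k) *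
          fderiv ℝ (fun y => pi1 (2*m+1) y i j + pi3 (2*m+1) y i j) x (Pi.single l 1)) = 0 := by
  have hJ := Inst.jac m hm i j k hi1 hi2 hj1 hj2 hk1 hk2
  unfold SkewBr.Jac at hJ
  rw [Inst.br_v _ _ _ hi1 hi2 hj1 hj2, Inst.br_v _ _ _ hj1 hj2 hk1 hk2,
    Inst.br_v _ _ _ hk1 hk2 hi1 hi2] at hJ
  have h0 := congrFun (congrArg Subtype.val hJ) (⟨x, hx⟩ : SmoothRing.U (2 * m + 1))
  have a1 := Inst.br_P (2 * m + 1) i j k hi1 hi2 ⟨x, hx⟩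
  have a2 := Inst.br_P (2 * m + 1) j k i hj1 hj2 ⟨x, hx⟩
  have a3 := Inst.br_P (2 * m + 1) k i j hk1 hk2 ⟨x, hx⟩
  rw [Finset.sum_add_distrib, Finset.sum_add_distrib, ← a1, ← a2, ← a3]
  simp only [Subalgebra.coe_add, Pi.add_apply] at h0
  first
  | linear_combination h0
  | (change _ = (0 : ℝ) at h0; linarith)
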